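/- Let σ > 0 and ζ > 0, and fix integers r ≥ 1 and s ≥ 1. Then lim_{n→∞} (-1)^{rs} (n)_{[rs]} binom(-σ,r)^s ζ^s · (∑_{j=0}^{n-rs} 𝒞(n-rs,j;-σ)(-ζ)^j) / (∑_{j=0}^{n} 𝒞(n,j;-σ)(-ζ)^j) = (σ (1+σ)_{(r-1)} ζ / r!)^s. Consequently the s-th falling factorial moment of the number M_r(-σ,-ζ,n) of blocks of size r under the NB-CPSM converges to the s-th falling factorial moment of a Poisson random variable with parameter σ (1+σ)_{(r-1)} ζ / r!, so M_r(-σ,-ζ,n) converges weakly to that Poisson distribution. -/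

import Mathlib

open Finset Filter Real MeasureTheory Topology Set

/-- Ascending factorial `(x)_{(n)} = x (x+1) ⋯ (x+n-1)`. -/
noncomputable def ascFact (x : ℝ) (n : ℕ) : ℝ := ∏ i ∈ Finset.range n, (x + i)

/-- Falling factorial `(a)_{[n]} = a (a-1) ⋯ (a-n+1)`. -/
noncomputable def fallFact (a : ℝ) (n : ℕ) : ℝ := ∏ i ∈ Finset.range n, (a - i)

/-- Generalized factorial coefficient
`𝒞(n,j;α) = (1/j!) ∑_{i=0}^{j} C(j,i) (-1)^i (-iα)_{(n)}`. -/
noncomputable def genFact (n j : ℕ) (α : ℝ) : ℝ :=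
  (1 / (Nat.factorial j : ℝ)) *
    ∑ i ∈ Finset.range (j + 1), (Nat.choose j i : ℝ) * (-1) ^ i * ascFact (-(i * α)) n

/-- Generalized binomial coefficient `binom(a,r) = a(a-1)⋯(a-r+1)/r!`. -/
noncomputable def genBinom (a : ℝ) (r : ℕ) : ℝ := fallFact a r / (Nat.factorial r : ℝ)

/-- If `(n + 1) a_{n+1} = ∑_{k ≤ n} β_k a_{n-k}` for positive sequences `a` and `β` with
`β_{k+1} - β_k = σ β_k / (k + 1)`, then consecutive ratios of `a` tend to one. -/
theorem tendsto_succ_div_of_convolution_recurrence {a β : ℕ → ℝ} {σ : ℝ} (hσ : 0 ≤ σ)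
    (ha : ∀ n, 0 < a n) (hβ : ∀ k, 0 < β k)
    (hβ_succ : ∀ k : ℕ, β (k + 1) = β k + σ / (k + 1) * β k)
    (hrec : ∀ n : ℕ, ((n : ℝ) + 1) * a (n + 1) = ∑ k ∈ Finset.range (n + 1), β k * a (n - k)) :
    Tendsto (fun n => a (n + 1) / a n) atTop (𝓝 1) := by
  have hpos : ∀ n : ℕ, 0 < ((n : ℝ) + 1) * a (n + 1) := fun n =>
    mul_pos (by positivity) (ha _)
  set w : ℕ → ℕ → ℝ := fun n k => β k * a (n - k) / (((n : ℝ) + 1) * a (n + 1)) with hw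
  have hw_nonneg : ∀ n k, 0 ≤ w n k := fun n k =>
    div_nonneg (mul_pos (hβ _) (ha _)).le (hpos n).le
  have hw_sum : ∀ n, ∑ k ∈ Finset.range (n + 1), w n k = 1 := by
    intro n
    rw [hw, ← Finset.sum_div, ← hrec, div_self (hpos n).ne']
  set S : ℕ → ℝ := fun n => ∑ k ∈ Finset.range (n + 1), w n k / ((k : ℝ) + 1) with hS
  have hS_nonneg : ∀ n, 0 ≤ S n := fun n =>
    Finset.sum_nonneg fun k _ => div_nonneg (hw_nonneg n k) (by positivity)
  have hdiff : ∀ n : ℕ, ((n : ℝ) + 2) * a (n + 2) =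
      ((n : ℝ) + 1) * a (n + 1) + β 0 * a (n + 1) + σ * S n * (((n : ℝ) + 1) * a (n + 1)) := by
    intro n
    have h := hrec (n + 1)
    rw [Finset.sum_range_succ'] at h
    have hS_mul : S n * (((n : ℝ) + 1) * a (n + 1)) =
        ∑ k ∈ Finset.range (n + 1), β k * a (n - k) / ((k : ℝ) + 1) := by
      rw [hS, Finset.sum_mul]
      refine Finset.sum_congr rfl fun k _ => ?_
      have := (ha (n + 1)).ne'
      simp only [hw]
      field_simp
    rw [mul_assoc σ, hS_mul, hrec n, Finset.mul_sum]
    have hsplit : ∑ k ∈ Finset.range (n + 1), β (k + 1) * a (n + 1 - (k + 1)) =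
        ∑ k ∈ Finset.range (n + 1), β k * a (n - k) +
          ∑ k ∈ Finset.range (n + 1), σ * (β k * a (n - k) / ((k : ℝ) + 1)) := by
      rw [← Finset.sum_add_distrib]
      refine Finset.sum_congr rfl fun k _ => ?_
      rw [hβ_succ, Nat.add_sub_add_right]
      ring
    rw [hsplit] at h
    push_cast at h
    rw [show (n : ℝ) + 2 = n + 1 + 1 by ring, h]
    ring
  have hmono : Monotone fun n : ℕ => (n : ℝ) * a n := by
    refine monotone_nat_of_le_succ fun n => ?_
    rcases n with _ | n
    · simpa using (ha 1).le
    · have h := hdiff n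
      have h1 := mul_pos (hβ 0) (ha (n + 1))
      have h2 := mul_nonneg (mul_nonneg hσ (hS_nonneg n)) (hpos n).le
      push_cast
      rw [show (n : ℝ) + 1 + 1 = n + 2 by ring]
      linarith
  have hw_tendsto : ∀ k, Tendsto (fun n => w n k) atTop (𝓝 0) := by
    intro k
    have hbound : Tendsto (fun n : ℕ => β k / ((n : ℝ) - k)) atTop (𝓝 0) :=
      tendsto_const_nhds.div_atTop
        (tendsto_atTop_add_const_right _ _ tendsto_natCast_atTop_atTop)
    refine tendsto_of_tendsto_of_tendsto_of_le_of_le' tendsto_const_nhds hbound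
      (Eventually.of_forall fun n => hw_nonneg n k) ?_
    filter_upwards [eventually_gt_atTop k] with n hn
    have hnk : (0 : ℝ) < (n : ℝ) - k := sub_pos.2 (by exact_mod_cast hn)
    have h := hmono (show n - k ≤ n + 1 by omega)
    simp only [Nat.cast_sub hn.le, Nat.cast_add, Nat.cast_one] at h
    rw [hw, div_le_div_iff₀ (hpos n) hnk]
    nlinarith [mul_le_mul_of_nonneg_left h (hβ k).le]
  have hS_tendsto : Tendsto S atTop (𝓝 0) := by
    rw [tendsto_order]
    refine ⟨fun c hc => Eventually.of_forall fun n => hc.trans_le (hS_nonneg n), fun ε hε => ?_⟩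
    obtain ⟨K, hK⟩ := exists_nat_one_div_lt (half_pos hε)
    have hfin : Tendsto (fun n => ∑ k ∈ Finset.range K, w n k) atTop (𝓝 0) := by
      simpa using tendsto_finsetSum (Finset.range K) fun k _ => hw_tendsto k
    filter_upwards [hfin.eventually_lt_const (half_pos hε), eventually_ge_atTop K] with n hn hKn
    have hterm : ∀ k ∈ Finset.range (n + 1), w n k / ((k : ℝ) + 1) ≤
        (if k < K then w n k else 0) + 1 / ((K : ℝ) + 1) * w n k := by
      intro k _
      have hwk := hw_nonneg n k
      split_ifs with hk
      · have : w n k / ((k : ℝ) + 1) ≤ w n k := div_le_self hwk (by simp)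
        have : 0 ≤ 1 / ((K : ℝ) + 1) * w n k := by positivity
        linarith
      · rw [zero_add, div_eq_mul_one_div, mul_comm]
        refine mul_le_mul_of_nonneg_right ?_ hwk
        refine one_div_le_one_div_of_le (by positivity) ?_
        have : (K : ℝ) ≤ k := by exact_mod_cast not_lt.1 hk
        linarith
    have hle := Finset.sum_le_sum hterm
    rw [Finset.sum_add_distrib, ← Finset.mul_sum, hw_sum, ← Finset.sum_filter,
      show (Finset.range (n + 1)).filter (fun k => k < K) = Finset.range K by
        ext k; simp; omega] at hle
    change ∑ k ∈ Finset.range (n + 1), w n k / ((k : ℝ) + 1) < ε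
    linarith
  rw [← tendsto_add_atTop_iff_nat 1]
  have hformula : ∀ n : ℕ, a (n + 1 + 1) / a (n + 1) =
      (1 - 1 / ((n : ℝ) + 2)) * (1 + σ * S n) + β 0 / ((n : ℝ) + 2) := by
    intro n
    have h := hdiff n
    have := (ha (n + 1)).ne'
    have h2 : (n : ℝ) + 2 ≠ 0 := by positivity
    field_simp
    linear_combination h
  simp_rw [hformula]
  have hdenom : Tendsto (fun n : ℕ => (n : ℝ) + 2) atTop atTop :=
    tendsto_atTop_add_const_right _ _ tendsto_natCast_atTop_atTop
  have hinv (c : ℝ) : Tendsto (fun n : ℕ => c / ((n : ℝ) + 2)) atTop (𝓝 0) :=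
    tendsto_const_nhds.div_atTop hdenom
  have hlim := (((hinv 1).const_sub 1).mul ((hS_tendsto.const_mul σ).const_add 1)).add
    (hinv (β 0))
  simpa using hlim

theorem tendsto_div_add_of_tendsto_succ_div {a : ℕ → ℝ} (ha : ∀ n, 0 < a n)
    (h : Tendsto (fun n => a (n + 1) / a n) atTop (𝓝 1)) (m : ℕ) :
    Tendsto (fun n => a n / a (n + m)) atTop (𝓝 1) := by
  induction m with
  | zero => simp [div_self (ha _).ne']
  | succ m ih =>
    have h' := ih.mul ((h.comp (tendsto_add_atTop_nat m)).inv₀ one_ne_zero)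
    simp only [inv_one, mul_one] at h'
    refine h'.congr fun n => ?_
    have h1 := (ha (n + m)).ne'
    have h2 := (ha (n + m + 1)).ne'
    simp only [Function.comp_apply, inv_div, ← add_assoc]
    field_simp

theorem ascFact_pos {x : ℝ} (hx : 0 < x) (n : ℕ) : 0 < ascFact x n :=
  Finset.prod_pos fun i _ => by positivity

theorem ascFact_succ (x : ℝ) (n : ℕ) : ascFact x (n + 1) = ascFact x n * (x + n) :=
  Finset.prod_range_succ _ _

theorem ascFact_succ' (x : ℝ) (n : ℕ) : ascFact x (n + 1) = x * ascFact (1 + x) n := by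
  rw [ascFact, ascFact, Finset.prod_range_succ', mul_comm]
  congr 1
  · simp
  · refine Finset.prod_congr rfl fun i _ => ?_
    push_cast
    ring

theorem fallFact_neg (x : ℝ) (n : ℕ) : fallFact (-x) n = (-1) ^ n * ascFact x n := by
  have h : ∀ i : ℕ, -x - (i : ℝ) = -1 * (x + i) := fun i => by ring
  simp_rw [fallFact, ascFact, h, Finset.prod_mul_distrib, Finset.prod_const, Finset.card_range]

theorem fallFact_natCast (n m : ℕ) : fallFact (n : ℝ) m = (n.descFactorial m : ℝ) := by
  rw [← descPochhammer_eval_eq_descFactorial, descPochhammer_eval_eq_prod_range, fallFact]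

theorem ringChoose_eq_fallFact_div (x : ℝ) (n : ℕ) :
    Ring.choose x n = fallFact x n / (n.factorial : ℝ) := by
  have h := Ring.descPochhammer_eq_factorial_smul_choose x n
  rw [← Polynomial.aeval_eq_smeval, ← Polynomial.eval_map_algebraMap,
    descPochhammer_map, descPochhammer_eval_eq_prod_range, nsmul_eq_mul] at h
  rw [fallFact, h, mul_div_cancel_left₀ _ (by positivity)]

/-- The power series of `(1 - X) ^ (-x)`. -/
noncomputable def ascSeries (x : ℝ) : PowerSeries ℝ :=
  PowerSeries.mk fun n => ascFact x n / (n.factorial : ℝ)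

theorem ascSeries_eq_rescale (x : ℝ) :
    ascSeries x = PowerSeries.rescale (-1) (PowerSeries.binomialSeries ℝ (-x)) := by
  ext n
  rw [ascSeries, PowerSeries.coeff_mk, PowerSeries.coeff_rescale,
    PowerSeries.binomialSeries_coeff, ringChoose_eq_fallFact_div, fallFact_neg, smul_eq_mul,
    mul_one, ← mul_div_assoc, ← mul_assoc, ← mul_pow]
  simp

theorem ascSeries_pow (x : ℝ) (i : ℕ) : ascSeries x ^ i = ascSeries (i * x) := by
  induction i with
  | zero => simp [ascSeries_eq_rescale]
  | succ i ih =>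
    rw [pow_succ, ih]
    simp only [ascSeries_eq_rescale]
    rw [← map_mul, ← PowerSeries.binomialSeries_add]
    congr 2
    push_cast
    ring

theorem coeff_one_sub_ascSeries_pow (σ : ℝ) (n j : ℕ) :
    PowerSeries.coeff n ((1 - ascSeries σ) ^ j) =
      (j.factorial : ℝ) / (n.factorial : ℝ) * genFact n j (-σ) := by
  have hj : (j.factorial : ℝ) ≠ 0 := by positivity
  have hn : (n.factorial : ℝ) ≠ 0 := by positivity
  rw [sub_eq_neg_add, add_pow, map_sum, genFact, ← mul_assoc, Finset.mul_sum]
  refine Finset.sum_congr rfl fun i _ => ?_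
  rw [neg_pow, ascSeries_pow, one_pow, mul_one, mul_comm,
    show ((j.choose i : PowerSeries ℝ) * ((-1) ^ i * ascSeries (i * σ))) =
      PowerSeries.C ((j.choose i : ℝ) * (-1) ^ i) * ascSeries (i * σ) by simp [mul_assoc],
    PowerSeries.coeff_C_mul, ascSeries, PowerSeries.coeff_mk, mul_neg, neg_neg]
  field_simp

theorem coeff_one_sub_ascSeries_pow_eq_zero (σ : ℝ) {n j : ℕ} (h : n < j) :
    PowerSeries.coeff n ((1 - ascSeries σ) ^ j) = 0 := by
  have hX : (PowerSeries.X : PowerSeries ℝ) ∣ 1 - ascSeries σ := by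
    rw [PowerSeries.X_dvd_iff, ← PowerSeries.coeff_zero_eq_constantCoeff_apply]
    simp [ascSeries, ascFact]
  exact PowerSeries.X_pow_dvd_iff.1 (pow_dvd_pow_of_dvd hX j) n h

theorem coeff_succ_one_sub_ascSeries_pow (σ : ℝ) (n j : ℕ) :
    ((n : ℝ) + 1) * PowerSeries.coeff (n + 1) ((1 - ascSeries σ) ^ (j + 1)) =
      -((j : ℝ) + 1) * ∑ k ∈ Finset.range (n + 1),
        ascFact σ (k + 1) / (k.factorial : ℝ) *
          PowerSeries.coeff (n - k) ((1 - ascSeries σ) ^ j) := by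
  rw [mul_comm, ← PowerSeries.coeff_derivative, PowerSeries.derivative_pow, map_sub,
    show ((((j + 1 : ℕ) : PowerSeries ℝ)) * (1 - ascSeries σ) ^ (j + 1 - 1) *
      (PowerSeries.derivative ℝ 1 - PowerSeries.derivative ℝ (ascSeries σ))) =
      PowerSeries.C (-((j : ℝ) + 1)) *
        (PowerSeries.derivative ℝ (ascSeries σ) * (1 - ascSeries σ) ^ j) by
      simp; ring,
    PowerSeries.coeff_C_mul, PowerSeries.coeff_mul,
    Finset.Nat.sum_antidiagonal_eq_sum_range_succ
      (fun k l => PowerSeries.coeff k (PowerSeries.derivative ℝ (ascSeries σ)) *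
        PowerSeries.coeff l ((1 - ascSeries σ) ^ j))]
  congr 1
  refine Finset.sum_congr rfl fun k _ => ?_
  rw [PowerSeries.coeff_derivative, ascSeries, PowerSeries.coeff_mk, Nat.factorial_succ]
  push_cast
  field_simp

/-- The coefficient of `t ^ n` in `exp (ζ ((1 - t) ^ (-σ) - 1))`. -/
noncomputable def nbCoeff (σ ζ : ℝ) (n : ℕ) : ℝ :=
  (∑ j ∈ Finset.range (n + 1), genFact n j (-σ) * (-ζ) ^ j) / (n.factorial : ℝ)

theorem nbCoeff_eq_sum (σ ζ : ℝ) {n N : ℕ} (h : n ≤ N) :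
    nbCoeff σ ζ n = ∑ j ∈ Finset.range (N + 1),
      PowerSeries.coeff n ((1 - ascSeries σ) ^ j) * ((-ζ) ^ j / (j.factorial : ℝ)) := by
  rw [← Finset.sum_subset (Finset.range_mono (Nat.succ_le_succ h)), nbCoeff, Finset.sum_div]
  · refine Finset.sum_congr rfl fun j _ => ?_
    rw [coeff_one_sub_ascSeries_pow]
    field_simp
  · intro j _ hj
    rw [coeff_one_sub_ascSeries_pow_eq_zero σ (by simpa using hj), zero_mul]

theorem nbCoeff_recurrence (σ ζ : ℝ) (n : ℕ) :
    ((n : ℝ) + 1) * nbCoeff σ ζ (n + 1) = ∑ k ∈ Finset.range (n + 1),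
      (ζ * ascFact σ (k + 1) / (k.factorial : ℝ)) * nbCoeff σ ζ (n - k) := by
  rw [nbCoeff_eq_sum σ ζ le_rfl, Finset.sum_range_succ', mul_add, Finset.mul_sum]
  simp only [← mul_assoc, coeff_succ_one_sub_ascSeries_pow]
  simp only [pow_zero, PowerSeries.coeff_one, Nat.succ_ne_zero, if_false, mul_zero, zero_mul,
    add_zero, Finset.mul_sum, Finset.sum_mul]
  rw [Finset.sum_comm]
  refine Finset.sum_congr rfl fun k _ => ?_
  rw [nbCoeff_eq_sum σ ζ (Nat.sub_le n k), Finset.mul_sum]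
  refine Finset.sum_congr rfl fun j _ => ?_
  rw [Nat.factorial_succ, pow_succ]
  push_cast
  field_simp

theorem nbCoeff_pos {σ ζ : ℝ} (hσ : 0 < σ) (hζ : 0 < ζ) (n : ℕ) : 0 < nbCoeff σ ζ n := by
  induction n using Nat.strong_induction_on with
  | _ n ih =>
    rcases n with _ | n
    · simp [nbCoeff, genFact, ascFact]
    · refine pos_of_mul_pos_right (a := (n : ℝ) + 1) ?_ (by positivity)
      rw [nbCoeff_recurrence]
      refine Finset.sum_pos (fun k _ => mul_pos ?_ (ih _ (by omega))) (by simp)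
      have := ascFact_pos hσ (k + 1)
      positivity

theorem nbCoeff_succ_div_tendsto {σ ζ : ℝ} (hσ : 0 < σ) (hζ : 0 < ζ) :
    Tendsto (fun n => nbCoeff σ ζ (n + 1) / nbCoeff σ ζ n) atTop (𝓝 1) := by
  refine tendsto_succ_div_of_convolution_recurrence hσ.le (nbCoeff_pos hσ hζ)
    (β := fun k => ζ * ascFact σ (k + 1) / (k.factorial : ℝ)) (fun k => ?_) (fun k => ?_)
    (nbCoeff_recurrence σ ζ)
  · have := ascFact_pos hσ (k + 1)
    positivity
  · simp only [ascFact_succ σ (k + 1), Nat.factorial_succ]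
    push_cast
    field_simp
    ring

/-- for `σ, ζ > 0` and fixed `r, s ≥ 1`, the `s`-th falling factorial moment of
`M_r(-σ,-ζ,n)` under the NB-CPSM converges to `(σ (1+σ)_{(r-1)} ζ / r!)^s`, the `s`-th falling
factorial moment of a Poisson random variable with that parameter. -/
theorem nbcpsm_falling_factorial_moment_tendsto_neg
    (σ ζ : ℝ) (hσ : 0 < σ) (hζ : 0 < ζ)
    (r s : ℕ) (hr : 1 ≤ r) (hs : 1 ≤ s) :
    Tendsto (fun n : ℕ =>
        (-1 : ℝ) ^ (r * s) * fallFact (n : ℝ) (r * s) * (genBinom (-σ) r) ^ s * ζ ^ s *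
          ((∑ j ∈ Finset.range (n - r * s + 1), genFact (n - r * s) j (-σ) * (-ζ) ^ j) /
           (∑ j ∈ Finset.range (n + 1), genFact n j (-σ) * (-ζ) ^ j)))
      atTop
      (𝓝 ((σ * ascFact (1 + σ) (r - 1) * ζ / (Nat.factorial r : ℝ)) ^ s)) := by
  rw [← tendsto_add_atTop_iff_nat (r * s)]
  have hlim := (tendsto_div_add_of_tendsto_succ_div (nbCoeff_pos hσ hζ)
    (nbCoeff_succ_div_tendsto hσ hζ) (r * s)).const_mul
    ((σ * ascFact (1 + σ) (r - 1) * ζ / (Nat.factorial r : ℝ)) ^ s)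
  rw [mul_one] at hlim
  refine hlim.congr fun n => ?_
  have hconst : (-1 : ℝ) ^ (r * s) * (genBinom (-σ) r) ^ s * ζ ^ s =
      (σ * ascFact (1 + σ) (r - 1) * ζ / (Nat.factorial r : ℝ)) ^ s := by
    rw [pow_mul, ← mul_pow, ← mul_pow, genBinom, fallFact_neg, ← ascFact_succ',
      Nat.sub_add_cancel hr, ← mul_div_assoc, ← mul_assoc, ← mul_pow]
    congr 1
    simp [mul_div_right_comm]
  have hdesc : ((n + r * s).descFactorial (r * s) : ℝ) =
      ((n + r * s).factorial : ℝ) / (n.factorial : ℝ) := by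
    rw [eq_div_iff (by positivity), mul_comm]
    have h := Nat.factorial_mul_descFactorial (Nat.le_add_left (r * s) n)
    rw [Nat.add_sub_cancel] at h
    exact_mod_cast h
  rw [← hconst, fallFact_natCast, hdesc, Nat.add_sub_cancel, nbCoeff, nbCoeff, div_div_div_eq]
  rw [mul_div_mul_comm, mul_comm (_ / _) (_ / _)]
  ring
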